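/- Let E and F be real normed vector spaces, let x⋆ ∈ E, λ⋆ ∈ F, let ζ₁, ζ₂, ζ₃, ω₃ > 0, and set ω₁ = ζ₁ + (ζ₁ + 1)ζ₂, ω₂ = (ζ₁ + 1)ζ₃, c = ω₃·(max(ω₁, ω₂))². Suppose (z_k)_{k∈ℕ}, (x_k)_{k∈ℕ}, (x̄_k)_{k∈ℕ} are sequences in E and (λ_k)_{k∈ℕ} is a sequence in F such that for all k: (i) ‖x̄_k − x_k‖ ≤ ζ₁‖z_k − x_k‖; (ii) ‖x_k − x⋆‖ ≤ ζ₂‖z_k − x⋆‖ + ζ₃‖λ_k − λ⋆‖; (iii) ‖z_{k+1} − x⋆‖ ≤ (ω₃/2)‖x̄_k − x⋆‖²; (iv) ‖λ_{k+1} − λ⋆‖ ≤ (ω₃/2)‖x̄_k − x⋆‖². If c·(‖z₀ − x⋆‖ + ‖λ₀ − λ⋆‖) < 1, then z_k → x⋆ and λ_k → λ⋆, and the combined errors e_k = ‖z_k − x⋆‖ + ‖λ_k − λ⋆‖ satisfy e_{k+1} ≤ c·e_k² for all k (quadratic convergence rate). -/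

import Mathlib

/-- A nonnegative sequence with a quadratic recursive bound tends to zero if it starts close
enough to zero. -/
theorem tendsto_zero_of_le_mul_sq {e : ℕ → ℝ} {c : ℝ} (hc : 0 ≤ c) (he : ∀ k, 0 ≤ e k)
    (hstep : ∀ k, e (k + 1) ≤ c * e k ^ 2) (hinit : c * e 0 < 1) :
    Filter.Tendsto e Filter.atTop (nhds 0) := by
  have hr : 0 ≤ c * e 0 := mul_nonneg hc (he 0)
  have hbound : ∀ k, e k ≤ (c * e 0) ^ k * e 0 := by
    intro k
    induction k with
    | zero => simp
    | succ k ih =>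
      have hk : e k ≤ e 0 :=
        ih.trans (mul_le_of_le_one_left (he 0) (pow_le_one₀ hr hinit.le))
      calc e (k + 1) ≤ c * e k ^ 2 := hstep k
        _ = (c * e k) * e k := by ring
        _ ≤ (c * e 0) * ((c * e 0) ^ k * e 0) :=
          mul_le_mul (mul_le_mul_of_nonneg_left hk hc) ih (he k) hr
        _ = (c * e 0) ^ (k + 1) * e 0 := by ring
  refine squeeze_zero he hbound ?_
  simpa using (tendsto_pow_atTop_nhds_zero_of_lt_one hr hinit).mul_const (e 0)

/-- An approximation `v` of `u` with error relative to `‖w - u‖` has distance to `p` controlled by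
the distances of `w` and `u` to `p`. -/
theorem norm_sub_le_of_relative_error {E : Type*} [SeminormedAddCommGroup E] {u v w p : E} {ζ : ℝ}
    (hζ : 0 ≤ ζ) (h : ‖v - u‖ ≤ ζ * ‖w - u‖) :
    ‖v - p‖ ≤ ζ * ‖w - p‖ + (ζ + 1) * ‖u - p‖ := by
  have hw : ‖w - u‖ ≤ ‖w - p‖ + ‖u - p‖ := by
    simpa only [norm_sub_rev p u] using norm_sub_le_norm_sub_add_norm_sub w p u
  linarith [norm_sub_le_norm_sub_add_norm_sub v u p, mul_le_mul_of_nonneg_left hw hζ]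

theorem aladin_local_quadratic_convergence {E F : Type*}
    [NormedAddCommGroup E] [NormedSpace ℝ E]
    [NormedAddCommGroup F] [NormedSpace ℝ F]
    (xstar : E) (lamstar : F) (ζ₁ ζ₂ ζ₃ ω₃ : ℝ)
    (hζ₁ : 0 < ζ₁) (hζ₂ : 0 < ζ₂) (hζ₃ : 0 < ζ₃) (hω₃ : 0 < ω₃)
    (z x xbar : ℕ → E) (lam : ℕ → F)
    (h1 : ∀ k, ‖xbar k - x k‖ ≤ ζ₁ * ‖z k - x k‖)
    (h2 : ∀ k, ‖x k - xstar‖ ≤ ζ₂ * ‖z k - xstar‖ + ζ₃ * ‖lam k - lamstar‖)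
    (h3 : ∀ k, ‖z (k + 1) - xstar‖ ≤ (ω₃ / 2) * ‖xbar k - xstar‖ ^ 2)
    (h4 : ∀ k, ‖lam (k + 1) - lamstar‖ ≤ (ω₃ / 2) * ‖xbar k - xstar‖ ^ 2)
    (hinit : (ω₃ * (max (ζ₁ + (ζ₁ + 1) * ζ₂) ((ζ₁ + 1) * ζ₃)) ^ 2)
        * (‖z 0 - xstar‖ + ‖lam 0 - lamstar‖) < 1) :
    Filter.Tendsto z Filter.atTop (nhds xstar) ∧
    Filter.Tendsto lam Filter.atTop (nhds lamstar) ∧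
    ∀ k, ‖z (k + 1) - xstar‖ + ‖lam (k + 1) - lamstar‖
      ≤ (ω₃ * (max (ζ₁ + (ζ₁ + 1) * ζ₂) ((ζ₁ + 1) * ζ₃)) ^ 2)
        * (‖z k - xstar‖ + ‖lam k - lamstar‖) ^ 2 := by
  set M := max (ζ₁ + (ζ₁ + 1) * ζ₂) ((ζ₁ + 1) * ζ₃)
  have hxbar : ∀ k, ‖xbar k - xstar‖ ≤ M * (‖z k - xstar‖ + ‖lam k - lamstar‖) := by
    intro k
    calc ‖xbar k - xstar‖
        ≤ ζ₁ * ‖z k - xstar‖ + (ζ₁ + 1) * ‖x k - xstar‖ :=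
          norm_sub_le_of_relative_error hζ₁.le (h1 k)
      _ ≤ ζ₁ * ‖z k - xstar‖
          + (ζ₁ + 1) * (ζ₂ * ‖z k - xstar‖ + ζ₃ * ‖lam k - lamstar‖) := by
        gcongr
        exact h2 k
      _ = (ζ₁ + (ζ₁ + 1) * ζ₂) * ‖z k - xstar‖ + ((ζ₁ + 1) * ζ₃) * ‖lam k - lamstar‖ := by
        ring
      _ ≤ M * ‖z k - xstar‖ + M * ‖lam k - lamstar‖ := by
        gcongr
        · exact le_max_left _ _
        · exact le_max_right _ _
      _ = M * (‖z k - xstar‖ + ‖lam k - lamstar‖) := by ring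
  have hquad : ∀ k, ‖z (k + 1) - xstar‖ + ‖lam (k + 1) - lamstar‖
      ≤ (ω₃ * M ^ 2) * (‖z k - xstar‖ + ‖lam k - lamstar‖) ^ 2 := by
    intro k
    calc ‖z (k + 1) - xstar‖ + ‖lam (k + 1) - lamstar‖
        ≤ ω₃ * ‖xbar k - xstar‖ ^ 2 := by linarith [h3 k, h4 k]
      _ ≤ ω₃ * (M * (‖z k - xstar‖ + ‖lam k - lamstar‖)) ^ 2 := by
        gcongr
        exact hxbar k
      _ = (ω₃ * M ^ 2) * (‖z k - xstar‖ + ‖lam k - lamstar‖) ^ 2 := by ring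
  have hlim : Filter.Tendsto (fun k => ‖z k - xstar‖ + ‖lam k - lamstar‖)
      Filter.atTop (nhds 0) :=
    tendsto_zero_of_le_mul_sq (by positivity) (fun k => by positivity) hquad hinit
  refine ⟨?_, ?_, hquad⟩
  · exact tendsto_iff_norm_sub_tendsto_zero.2 <| squeeze_zero (fun k => norm_nonneg _)
      (fun k => le_add_of_nonneg_right (norm_nonneg _)) hlim
  · exact tendsto_iff_norm_sub_tendsto_zero.2 <| squeeze_zero (fun k => norm_nonneg _)
      (fun k => le_add_of_nonneg_left (norm_nonneg _)) hlim
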